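/- Let M > 0, let r : ℝ² → ℝ be a Schwarzschild double-null radius function, and let Ψ : ℝ² → ℝ be a smooth solution of the spherically symmetric wave equation. Define the symplectic T-current fluxes ℰ_u(v₀,v₁) := (1/2)·∫_{v₀}^{v₁} r²·( ∂_uΨ·∂_vΨ + (∂_vΨ)² − Ψ·∂_v²Ψ − Ψ·∂_u∂_vΨ )(u,v) dv and ℰ_v(u₀,u₁) := (1/2)·∫_{u₀}^{u₁} r²·( ∂_uΨ·∂_vΨ + (∂_uΨ)² − Ψ·∂_u²Ψ − Ψ·∂_u∂_vΨ )(u,v) du, the coercive T-energy fluxes E_u(v₀,v₁) := ∫_{v₀}^{v₁} r²·(∂_vΨ)²(u,v) dv and E̲_v(u₀,u₁) := ∫_{u₀}^{u₁} r²·(∂_uΨ)²(u,v) du, and the boundary quantity B(u,v) := (1/2)·r²·Ψ·(∂_vΨ − ∂_uΨ). Then for all real u, v₀, v₁: ℰ_u(v₀,v₁) = E_u(v₀,v₁) − ( B(u,v₁) − B(u,v₀) ), and for all real v, u₀, u₁: ℰ_v(u₀,u₁) = E̲_v(u₀,u₁) + ( B(u₁,v) − B(u₀,v) ). (This is the identity,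 obtained by integration by parts using the wave equation, that reveals the coercivity of the symplectic T-current fluxes: the difference between the symplectic flux and the coercive energy flux is a pure boundary term proportional to 𝒜 = (1/4)Ψ(∂_vΨ − ∂_uΨ), restricted here to spherically symmetric solutions.) -/

import Mathlib

open MeasureTheory Filter Set

/-- Partial derivative in the first (u) variable. -/
noncomputable def pdu (f : ℝ → ℝ → ℝ) (u v : ℝ) : ℝ := deriv (fun x => f x v) u

/-- Partial derivative in the second (v) variable. -/
noncomputable def pdv (f : ℝ → ℝ → ℝ) (u v : ℝ) : ℝ := deriv (fun y => f u y) v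

/-- Schwarzschild double-null radius function: smooth, `r > 2M`,
`∂r/∂v = 1 − 2M/r`, `∂r/∂u = −(1 − 2M/r)`. -/
def IsSchwRadius (M : ℝ) (r : ℝ → ℝ → ℝ) : Prop :=
  ContDiff ℝ (⊤ : ℕ∞) (Function.uncurry r) ∧
  (∀ u v, 2 * M < r u v) ∧
  (∀ u v, pdv r u v = 1 - 2 * M / r u v) ∧
  (∀ u v, pdu r u v = -(1 - 2 * M / r u v))

/-- A smooth solution of the spherically symmetric wave equation
`∂²Ψ/∂u∂v = (Ω²/r)(∂Ψ/∂v − ∂Ψ/∂u)` on the Schwarzschild exterior,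
where `Ω² = 1 − 2M/r`. -/
def IsWaveSolution (M : ℝ) (r Ψ : ℝ → ℝ → ℝ) : Prop :=
  ContDiff ℝ (⊤ : ℕ∞) (Function.uncurry Ψ) ∧
  ∀ u v, pdu (fun a b => pdv Ψ a b) u v =
    ((1 - 2 * M / r u v) / r u v) * (pdv Ψ u v - pdu Ψ u v)

/-- Symplectic `T`-current density along the outgoing cones (integrand of `ℰ_u`). -/
noncomputable def symplDensU (r Ψ : ℝ → ℝ → ℝ) (u v : ℝ) : ℝ :=
  (r u v) ^ 2 *
    (pdu Ψ u v * pdv Ψ u v + (pdv Ψ u v) ^ 2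
      - Ψ u v * pdv (fun a b => pdv Ψ a b) u v
      - Ψ u v * pdu (fun a b => pdv Ψ a b) u v)

/-- Symplectic `T`-current density along the ingoing cones (integrand of `ℰ_v`). -/
noncomputable def symplDensV (r Ψ : ℝ → ℝ → ℝ) (u v : ℝ) : ℝ :=
  (r u v) ^ 2 *
    (pdu Ψ u v * pdv Ψ u v + (pdu Ψ u v) ^ 2
      - Ψ u v * pdu (fun a b => pdu Ψ a b) u v
      - Ψ u v * pdu (fun a b => pdv Ψ a b) u v)

/-- Boundary quantity `B = (1/2) r² Ψ (∂_vΨ − ∂_uΨ)` (twice the integrand `𝒜`). -/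
noncomputable def Bbdry (r Ψ : ℝ → ℝ → ℝ) (u v : ℝ) : ℝ :=
  (1 / 2) * (r u v) ^ 2 * Ψ u v * (pdv Ψ u v - pdu Ψ u v)

section PartialDerivatives

variable {f : ℝ → ℝ → ℝ}

lemma hasDerivAt_uncurry_left (hf : Differentiable ℝ (Function.uncurry f)) (u v : ℝ) :
    HasDerivAt (fun x => f x v) (fderiv ℝ (Function.uncurry f) (u, v) (1, 0)) u :=
  HasFDerivAt.comp_hasDerivAt (f := fun x : ℝ => (x, v)) u (hf (u, v)).hasFDerivAt
    ((hasDerivAt_id u).prodMk (hasDerivAt_const u v))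

lemma hasDerivAt_uncurry_right (hf : Differentiable ℝ (Function.uncurry f)) (u v : ℝ) :
    HasDerivAt (fun y => f u y) (fderiv ℝ (Function.uncurry f) (u, v) (0, 1)) v :=
  HasFDerivAt.comp_hasDerivAt (f := fun y : ℝ => (u, y)) v (hf (u, v)).hasFDerivAt
    ((hasDerivAt_const v u).prodMk (hasDerivAt_id v))

lemma pdu_eq_fderiv (hf : Differentiable ℝ (Function.uncurry f)) (u v : ℝ) :
    pdu f u v = fderiv ℝ (Function.uncurry f) (u, v) (1, 0) :=
  (hasDerivAt_uncurry_left hf u v).deriv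

lemma pdv_eq_fderiv (hf : Differentiable ℝ (Function.uncurry f)) (u v : ℝ) :
    pdv f u v = fderiv ℝ (Function.uncurry f) (u, v) (0, 1) :=
  (hasDerivAt_uncurry_right hf u v).deriv

lemma hasDerivAt_pdu (hf : Differentiable ℝ (Function.uncurry f)) (u v : ℝ) :
    HasDerivAt (fun x => f x v) (pdu f u v) u :=
  (hasDerivAt_uncurry_left hf u v).differentiableAt.hasDerivAt

lemma hasDerivAt_pdv (hf : Differentiable ℝ (Function.uncurry f)) (u v : ℝ) :
    HasDerivAt (fun y => f u y) (pdv f u v) v :=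
  (hasDerivAt_uncurry_right hf u v).differentiableAt.hasDerivAt

lemma uncurry_pdu (hf : Differentiable ℝ (Function.uncurry f)) :
    Function.uncurry (pdu f) = fun p => fderiv ℝ (Function.uncurry f) p (1, 0) :=
  funext fun p => pdu_eq_fderiv hf p.1 p.2

lemma uncurry_pdv (hf : Differentiable ℝ (Function.uncurry f)) :
    Function.uncurry (pdv f) = fun p => fderiv ℝ (Function.uncurry f) p (0, 1) :=
  funext fun p => pdv_eq_fderiv hf p.1 p.2

lemma contDiff_pdu (hf : ContDiff ℝ (⊤ : ℕ∞) (Function.uncurry f)) :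
    ContDiff ℝ (⊤ : ℕ∞) (Function.uncurry (pdu f)) := by
  rw [uncurry_pdu (hf.differentiable (by simp))]
  exact (hf.fderiv_right (by simp)).clm_apply contDiff_const

lemma contDiff_pdv (hf : ContDiff ℝ (⊤ : ℕ∞) (Function.uncurry f)) :
    ContDiff ℝ (⊤ : ℕ∞) (Function.uncurry (pdv f)) := by
  rw [uncurry_pdv (hf.differentiable (by simp))]
  exact (hf.fderiv_right (by simp)).clm_apply contDiff_const

/-- Mixed partial derivatives of a smooth function commute. -/
lemma pdv_pdu_eq_pdu_pdv (hf : ContDiff ℝ (⊤ : ℕ∞) (Function.uncurry f)) (u v : ℝ) :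
    pdv (pdu f) u v = pdu (pdv f) u v := by
  have hd : Differentiable ℝ (Function.uncurry f) := hf.differentiable (by simp)
  have hd' : Differentiable ℝ (fderiv ℝ (Function.uncurry f)) :=
    (hf.fderiv_right (m := (⊤ : ℕ∞)) (by simp)).differentiable (by simp)
  have hsymm : IsSymmSndFDerivAt ℝ (Function.uncurry f) (u, v) :=
    hf.contDiffAt.isSymmSndFDerivAt (by
      rw [minSmoothness_of_isRCLikeNormedField]
      exact WithTop.coe_le_coe.2 (le_top : (2 : ℕ∞) ≤ ⊤))
  rw [pdv_eq_fderiv ((contDiff_pdu hf).differentiable (by simp)),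
    pdu_eq_fderiv ((contDiff_pdv hf).differentiable (by simp)), uncurry_pdu hd, uncurry_pdv hd,
    fderiv_clm_apply (hd' _) (differentiableAt_const _),
    fderiv_clm_apply (hd' _) (differentiableAt_const _)]
  simpa using hsymm (0, 1) (1, 0)

lemma continuous_of_uncurry_left (hf : ContDiff ℝ (⊤ : ℕ∞) (Function.uncurry f)) (v : ℝ) :
    Continuous fun u => f u v :=
  hf.continuous.comp (by fun_prop : Continuous fun u : ℝ => (u, v))

lemma continuous_of_uncurry_right (hf : ContDiff ℝ (⊤ : ℕ∞) (Function.uncurry f)) (u : ℝ) :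
    Continuous fun v => f u v :=
  hf.continuous.comp (by fun_prop : Continuous fun v : ℝ => (u, v))

end PartialDerivatives

section BoundaryTerm

variable {M : ℝ} {r Ψ : ℝ → ℝ → ℝ}

lemma IsSchwRadius.ne_zero (hM : 0 < M) (hr : IsSchwRadius M r) (u v : ℝ) : r u v ≠ 0 := by
  have : 0 < r u v := by linarith [hr.2.1 u v]
  exact this.ne'

lemma hasDerivAt_Bbdry_right (hM : 0 < M) (hr : IsSchwRadius M r) (hΨ : IsWaveSolution M r Ψ)
    (u v : ℝ) :
    HasDerivAt (fun y => Bbdry r Ψ u y)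
      ((r u v) ^ 2 * (pdv Ψ u v) ^ 2 - (1 / 2) * symplDensU r Ψ u v) v := by
  have hr0 := hr.ne_zero hM u v
  have dr := hasDerivAt_pdv (hr.1.differentiable (by simp)) u v
  have dΨ := hasDerivAt_pdv (hΨ.1.differentiable (by simp)) u v
  have dv := hasDerivAt_pdv ((contDiff_pdv hΨ.1).differentiable (by simp)) u v
  have du := hasDerivAt_pdv ((contDiff_pdu hΨ.1).differentiable (by simp)) u v
  rw [pdv_pdu_eq_pdu_pdv hΨ.1, hΨ.2 u v] at du
  rw [hr.2.2.1] at dr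
  refine ((((dr.fun_pow 2).const_mul (1 / 2)).fun_mul dΨ).fun_mul (dv.fun_sub du)).congr_deriv ?_
  rw [symplDensU, hΨ.2 u v]
  field_simp
  ring

lemma hasDerivAt_Bbdry_left (hM : 0 < M) (hr : IsSchwRadius M r) (hΨ : IsWaveSolution M r Ψ)
    (u v : ℝ) :
    HasDerivAt (fun x => Bbdry r Ψ x v)
      ((1 / 2) * symplDensV r Ψ u v - (r u v) ^ 2 * (pdu Ψ u v) ^ 2) u := by
  have hr0 := hr.ne_zero hM u v
  have dr := hasDerivAt_pdu (hr.1.differentiable (by simp)) u v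
  have dΨ := hasDerivAt_pdu (hΨ.1.differentiable (by simp)) u v
  have dv := hasDerivAt_pdu ((contDiff_pdv hΨ.1).differentiable (by simp)) u v
  have du := hasDerivAt_pdu ((contDiff_pdu hΨ.1).differentiable (by simp)) u v
  rw [hΨ.2 u v] at dv
  rw [hr.2.2.2] at dr
  refine ((((dr.fun_pow 2).const_mul (1 / 2)).fun_mul dΨ).fun_mul (dv.fun_sub du)).congr_deriv ?_
  rw [symplDensV, hΨ.2 u v]
  field_simp
  ring

lemma continuous_symplDensU_right (hr : ContDiff ℝ (⊤ : ℕ∞) (Function.uncurry r))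
    (hΨ : ContDiff ℝ (⊤ : ℕ∞) (Function.uncurry Ψ)) (u : ℝ) :
    Continuous fun v => symplDensU r Ψ u v := by
  have hv := contDiff_pdv hΨ
  have cr := continuous_of_uncurry_right hr u
  have cΨ := continuous_of_uncurry_right hΨ u
  have cu := continuous_of_uncurry_right (contDiff_pdu hΨ) u
  have cv := continuous_of_uncurry_right hv u
  have cvv := continuous_of_uncurry_right (contDiff_pdv hv) u
  have cuv := continuous_of_uncurry_right (contDiff_pdu hv) u
  exact (cr.pow 2).mul ((((cu.mul cv).add (cv.pow 2)).sub (cΨ.mul cvv)).sub (cΨ.mul cuv))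

lemma continuous_symplDensV_left (hr : ContDiff ℝ (⊤ : ℕ∞) (Function.uncurry r))
    (hΨ : ContDiff ℝ (⊤ : ℕ∞) (Function.uncurry Ψ)) (v : ℝ) :
    Continuous fun u => symplDensV r Ψ u v := by
  have hu := contDiff_pdu hΨ
  have hv := contDiff_pdv hΨ
  have cr := continuous_of_uncurry_left hr v
  have cΨ := continuous_of_uncurry_left hΨ v
  have cu := continuous_of_uncurry_left hu v
  have cv := continuous_of_uncurry_left hv v
  have cuu := continuous_of_uncurry_left (contDiff_pdu hu) v
  have cuv := continuous_of_uncurry_left (contDiff_pdu hv) v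
  exact (cr.pow 2).mul ((((cu.mul cv).add (cu.pow 2)).sub (cΨ.mul cuu)).sub (cΨ.mul cuv))

end BoundaryTerm

/-- The symplectic `T`-current fluxes differ from the coercive `T`-energy fluxes by a
pure boundary term:
`ℰ_u = E_u − (B(u,v₁) − B(u,v₀))` and `ℰ_v = E̲_v + (B(u₁,v) − B(u₀,v))`. -/
theorem symplectic_flux_coercivity_identity
    (M : ℝ) (hM : 0 < M) (r Ψ : ℝ → ℝ → ℝ)
    (hr : IsSchwRadius M r) (hΨ : IsWaveSolution M r Ψ) :
    (∀ u v₀ v₁ : ℝ,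
      (1 / 2) * (∫ v in v₀..v₁, symplDensU r Ψ u v) =
        (∫ v in v₀..v₁, (r u v) ^ 2 * (pdv Ψ u v) ^ 2)
          - (Bbdry r Ψ u v₁ - Bbdry r Ψ u v₀)) ∧
    (∀ v u₀ u₁ : ℝ,
      (1 / 2) * (∫ u in u₀..u₁, symplDensV r Ψ u v) =
        (∫ u in u₀..u₁, (r u v) ^ 2 * (pdu Ψ u v) ^ 2)
          + (Bbdry r Ψ u₁ v - Bbdry r Ψ u₀ v)) := by
  refine ⟨fun u v₀ v₁ => ?_, fun v u₀ u₁ => ?_⟩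
  · have hS := (continuous_symplDensU_right hr.1 hΨ.1 u).const_mul (1 / 2)
    have hE : Continuous fun v => (r u v) ^ 2 * (pdv Ψ u v) ^ 2 :=
      ((continuous_of_uncurry_right hr.1 u).pow 2).mul
        ((continuous_of_uncurry_right (contDiff_pdv hΨ.1) u).pow 2)
    rw [← intervalIntegral.integral_eq_sub_of_hasDerivAt
        (fun y _ => hasDerivAt_Bbdry_right hM hr hΨ u y)
        ((hE.sub hS).intervalIntegrable v₀ v₁),
      intervalIntegral.integral_sub (hE.intervalIntegrable _ _) (hS.intervalIntegrable _ _),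
      intervalIntegral.integral_const_mul]
    ring
  · have hS := (continuous_symplDensV_left hr.1 hΨ.1 v).const_mul (1 / 2)
    have hE : Continuous fun u => (r u v) ^ 2 * (pdu Ψ u v) ^ 2 :=
      ((continuous_of_uncurry_left hr.1 v).pow 2).mul
        ((continuous_of_uncurry_left (contDiff_pdu hΨ.1) v).pow 2)
    rw [← intervalIntegral.integral_eq_sub_of_hasDerivAt
        (fun x _ => hasDerivAt_Bbdry_left hM hr hΨ x v)
        ((hS.sub hE).intervalIntegrable u₀ u₁),
      intervalIntegral.integral_sub (hS.intervalIntegrable _ _) (hE.intervalIntegrable _ _),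
      intervalIntegral.integral_const_mul]
    ring
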